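/- arXiv:2312.15599 — 2 statements merged into one kernel-verified Lean document; each statement's English description precedes it below -/
import Mathlib

section
/- Let (Ω, F, μ) be a probability space and let S, Ŝ : Ω → {0,1} be measurable random variables. Fix s ∈ {0,1} and assume μ(S = s) = μ(Ŝ = s) and μ(S = s) > 0. Then the total variation distance between the conditional probability measures μ(· | S = s) and μ(Ŝ(· | Ŝ = s)), i.e. sup over measurable events A of |μ(A | S = s) − μ(A | Ŝ = s)|, is at most the conditional probability μ(S ≠ Ŝ | S = s) that the sensitive attribute is incorrectly reconstructed. -/
open MeasureTheory

/-- Main theorem: the total variation distance between the conditional probabilities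
`μ(· | S = s)` and `μ(· | Ŝ = s)`, i.e. the supremum over measurable events `A` of
`|μ(A | S = s) − μ(A | Ŝ = s)|`, is bounded by `μ(S ≠ Ŝ | S = s)`, assuming
`μ(S = s) = μ(Ŝ = s)` and `μ(S = s) > 0`.  Conditional probability is
`μ(A | B) = μ(A ∩ B) / μ(B)`. -/
theorem tv_dist_cond_le_mismatch
    {Ω : Type*} [MeasurableSpace Ω] (μ : Measure Ω) [IsProbabilityMeasure μ]
    (S Shat : Ω → Bool) (hS : Measurable S) (hShat : Measurable Shat) (s : Bool)
    (heq : μ {ω | S ω = s} = μ {ω | Shat ω = s})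
    (hpos : 0 < μ {ω | S ω = s}) :
    (⨆ (A : Set Ω) (_ : MeasurableSet A),
        |(μ (A ∩ {ω | S ω = s})).toReal / (μ {ω | S ω = s}).toReal -
          (μ (A ∩ {ω | Shat ω = s})).toReal / (μ {ω | Shat ω = s}).toReal|) ≤
      (μ ({ω | S ω ≠ Shat ω} ∩ {ω | S ω = s})).toReal / (μ {ω | S ω = s}).toReal := by
  have hB : MeasurableSet {ω | S ω = s} := hS (measurableSet_singleton s)
  have hC : MeasurableSet {ω | Shat ω = s} := hShat (measurableSet_singleton s)
  have hD : {ω | S ω ≠ Shat ω} ∩ {ω | S ω = s} = {ω | S ω = s} \ {ω | Shat ω = s} := by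
    ext ω
    simp only [Set.mem_inter_iff, Set.mem_diff, Set.mem_setOf_eq]
    constructor
    · rintro ⟨h1, h2⟩
      exact ⟨h2, fun h3 => h1 (h2.trans h3.symm)⟩
    · rintro ⟨h1, h2⟩
      exact ⟨fun h3 => h2 (h3.symm.trans h1), h1⟩
  rw [hD, ← heq]
  have hp : 0 < (μ {ω | S ω = s}).toReal := ENNReal.toReal_pos hpos.ne' (measure_ne_top _ _)
  have heq' : μ.real {ω | S ω = s} = μ.real {ω | Shat ω = s} := congrArg ENNReal.toReal heq
  simp only [← measureReal_def] at hp ⊢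
  generalize {ω | S ω = s} = B at *
  generalize {ω | Shat ω = s} = C at *
  refine Real.iSup_le (fun A => Real.iSup_le (fun _ => ?_) (by positivity)) (by positivity)
  rw [← sub_div, abs_div, abs_of_pos hp]
  gcongr
  have e1 := measureReal_inter_add_diff (μ := μ) (s := A ∩ B) hC
  have e2 := measureReal_inter_add_diff (μ := μ) (s := A ∩ C) hB
  have e3 := measureReal_inter_add_diff (μ := μ) (s := B) hC
  have e4 := measureReal_inter_add_diff (μ := μ) (s := C) hB
  rw [Set.inter_right_comm] at e2
  rw [Set.inter_comm C B] at e4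
  have l1 : μ.real ((A ∩ B) \ C) ≤ μ.real (B \ C) :=
    measureReal_mono (Set.diff_subset_diff_left Set.inter_subset_right)
  have l2 : μ.real ((A ∩ C) \ B) ≤ μ.real (C \ B) :=
    measureReal_mono (Set.diff_subset_diff_left Set.inter_subset_right)
  have n1 : 0 ≤ μ.real ((A ∩ B) \ C) := measureReal_nonneg
  have n2 : 0 ≤ μ.real ((A ∩ C) \ B) := measureReal_nonneg
  rw [abs_le]
  constructor <;> linarith
end

section
/- Let (Ω, F, μ) be a probability space and let S, Ŝ : Ω → {0,1} be measurable random variables. Fix s ∈ {0,1} with μ(S = s) > 0 and μ(Ŝ = s) > 0, and assume μ(S = s) = μ(Ŝ = s). Then for every measurable event A ∈ F, |μ(A | S = s) − μ(A | Ŝ = s)| ≤ μ(S ≠ Ŝ | S = s). -/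
open MeasureTheory

/-- Pointwise (per-event) form of the main theorem: assuming
`μ(S = s) = μ(Ŝ = s)` (both positive), for every measurable event `A`,
`|μ(A | S = s) − μ(A | Ŝ = s)| ≤ μ(S ≠ Ŝ | S = s)`, where
`μ(A | B) = μ(A ∩ B)/μ(B)`. -/
theorem abs_cond_diff_le_mismatch
    {Ω : Type*} [MeasurableSpace Ω] (μ : Measure Ω) [IsProbabilityMeasure μ]
    (S Shat : Ω → Bool) (hS : Measurable S) (hShat : Measurable Shat) (s : Bool)
    (hposS : 0 < μ {ω | S ω = s}) (hposShat : 0 < μ {ω | Shat ω = s})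
    (heq : μ {ω | S ω = s} = μ {ω | Shat ω = s})
    (A : Set Ω) (hA : MeasurableSet A) :
    |(μ (A ∩ {ω | S ω = s})).toReal / (μ {ω | S ω = s}).toReal -
        (μ (A ∩ {ω | Shat ω = s})).toReal / (μ {ω | Shat ω = s}).toReal| ≤
      (μ ({ω | S ω ≠ Shat ω} ∩ {ω | S ω = s})).toReal / (μ {ω | S ω = s}).toReal := by
  have hC : MeasurableSet {ω | Shat ω = s} := hShat (measurableSet_singleton s)
  have hB : MeasurableSet {ω | S ω = s} := hS (measurableSet_singleton s)
  have hM : {ω | S ω ≠ Shat ω} ∩ {ω | S ω = s} = {ω | S ω = s} \ {ω | Shat ω = s} := by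
    ext ω
    simp only [Set.mem_inter_iff, Set.mem_setOf_eq, Set.mem_diff]
    grind
  rw [hM, ← heq, ← sub_div, abs_div, abs_of_nonneg (ENNReal.toReal_nonneg (a := μ {ω | S ω = s}))]
  refine div_le_div_of_nonneg_right ?_ ENNReal.toReal_nonneg
  have heq' : μ.real {ω | S ω = s} = μ.real {ω | Shat ω = s} := congrArg ENNReal.toReal heq
  change |μ.real _ - μ.real _| ≤ μ.real _
  generalize {ω | S ω = s} = B at *
  generalize {ω | Shat ω = s} = C at *
  have e1 := measureReal_diff_add_inter (μ := μ) (s := B) (t := C) hC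
  have e2 := measureReal_diff_add_inter (μ := μ) (s := C) (t := B) hB
  rw [Set.inter_comm] at e2
  have key : ∀ X Y : Set Ω, μ.real (A ∩ X) ≤ μ.real (A ∩ Y) + μ.real (X \ Y) := by
    intro X Y
    refine (measureReal_mono ?_).trans (measureReal_union_le _ _)
    intro ω h
    by_cases hy : ω ∈ Y
    · exact Or.inl ⟨h.1, hy⟩
    · exact Or.inr ⟨h.2, hy⟩
  have k1 := key B C
  have k2 := key C B
  rw [abs_le]
  constructor <;> linarith
end
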